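/- arXiv:2406.18781 — 2 statements merged into one kernel-verified Lean document; each statement's English description precedes it below -/
import Mathlib

section
/- Let L ∈ ℝ^n and v ∈ ℝ. Then every x ∈ ℝ^n that is integral, satisfies x_j ≥ 0 for all j, and satisfies Lᵀ x = v also satisfies the Gomory cut ∑_{j=1}^n (⌊L_j⌋ − L_j) · x_j ≤ ⌊v⌋ − v, where ⌊·⌋ denotes the floor function. Equivalently, (−L + ⌊L⌋)ᵀ x ≤ −v + ⌊v⌋ for every nonnegative integral solution x of the tableau row equation Lᵀ x = v. -/
open scoped Matrix

/-- Every nonnegative integral solution of the tableau row equation `Lᵀ x = v`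
satisfies the Gomory cut `∑ j, (⌊L j⌋ − L j) * x j ≤ ⌊v⌋ − v`. -/
theorem gomory_cut_valid {n : ℕ} (L : Fin n → ℝ) (v : ℝ)
    (x : Fin n → ℝ)
    (hint : ∀ j, ∃ z : ℤ, x j = (z : ℝ))
    (hpos : ∀ j, 0 ≤ x j)
    (heq : L ⬝ᵥ x = v) :
    ∑ j, ((⌊L j⌋ : ℝ) - L j) * x j ≤ (⌊v⌋ : ℝ) - v := by
  choose z hz using hint
  have h_split : ∑ j, ((⌊L j⌋ : ℝ) - L j) * x j = ∑ j, (⌊L j⌋ : ℝ) * x j - v := by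
    simp only [← heq, dotProduct, sub_mul, Finset.sum_sub_distrib]
  have h_le : ∑ j, (⌊L j⌋ : ℝ) * x j ≤ v := by
    rw [← heq, dotProduct]
    exact Finset.sum_le_sum fun j _ =>
      mul_le_mul_of_nonneg_right (Int.floor_le (L j)) (hpos j)
  have h_cast : ∑ j, (⌊L j⌋ : ℝ) * x j = ((∑ j, ⌊L j⌋ * z j : ℤ) : ℝ) := by
    push_cast
    simp only [hz]
  rw [h_split, h_cast]
  rw [h_cast] at h_le
  exact sub_le_sub_right (Int.cast_le.mpr (Int.le_floor.mpr h_le)) v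
end

section
/- (Corollary 1.) Let c ∈ ℝ^n have integer entries, let H, P_k, and P̂_{k+1} be finite sets of linear constraints (pairs (α, β) representing αᵀ x ≤ β) with P̂_{k+1} ⊆ H ∪ P_k, and for a set S of constraints write F(S) = {x ∈ ℝ^n : αᵀ x ≤ β for all (α, β) ∈ S}. Assume every constraint in P_k is satisfied by every integral point of F(H). Suppose x_k* ∈ F(H ∪ P̂_{k+1}) satisfies cᵀ x_k* ≤ cᵀ y for all y ∈ F(H ∪ P̂_{k+1}), and define P_{k+1} = P̂_{k+1} ∪ {(−c, −⌈cᵀ x_k*⌉)}, i.e., P̂_{k+1} together with the constraint cᵀ x ≥ ⌈cᵀ x_k*⌉. Then the integral points of F(H ∪ P_{k+1}) that minimize cᵀ x over integral points of F(H ∪ P_{k+1}) coincide exactly with the integral points of F(H) that minimize cᵀ x over integral points of F(H); in particular, adding the special constraint cᵀ x ≥ ⌈cᵀ x_k*⌉ does not affect the optimal integral solution. -/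
open scoped Matrix

/-- The dot product of two real vectors with integer entries is an integer. -/
theorem exists_int_eq_dotProduct {ι : Type*} [Fintype ι] {u v : ι → ℝ}
    (hu : ∀ j, ∃ z : ℤ, u j = (z : ℝ)) (hv : ∀ j, ∃ z : ℤ, v j = (z : ℝ)) :
    ∃ m : ℤ, u ⬝ᵥ v = (m : ℝ) := by
  choose a ha using hu
  choose b hb using hv
  exact ⟨a ⬝ᵥ b, by simp [dotProduct, ha, hb]⟩

/-- Corollary 1: adding the special constraint `cᵀ x ≥ ⌈cᵀ x_k*⌉` on top of the retained
cuts does not affect the optimal integral solutions. -/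
theorem special_constraint_preserves_integral_optimum {n : ℕ}
    (c : Fin n → ℝ) (hc : ∀ j, ∃ z : ℤ, c j = (z : ℝ))
    (H Pk Phat : Finset ((Fin n → ℝ) × ℝ))
    (hsub : Phat ⊆ H ∪ Pk)
    (F : Finset ((Fin n → ℝ) × ℝ) → Set (Fin n → ℝ))
    (hF : ∀ S, F S = {x | ∀ p ∈ S, p.1 ⬝ᵥ x ≤ p.2})
    (hvalid : ∀ y ∈ F H, (∀ j, ∃ z : ℤ, y j = (z : ℝ)) → ∀ p ∈ Pk, p.1 ⬝ᵥ y ≤ p.2)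
    (xk : Fin n → ℝ) (hxk : xk ∈ F (H ∪ Phat))
    (hxkmin : ∀ y ∈ F (H ∪ Phat), c ⬝ᵥ xk ≤ c ⬝ᵥ y)
    (Pk1 : Finset ((Fin n → ℝ) × ℝ))
    (hPk1 : Pk1 = insert (-c, -((⌈c ⬝ᵥ xk⌉ : ℤ) : ℝ)) Phat) :
    {x | x ∈ F (H ∪ Pk1) ∧ (∀ j, ∃ z : ℤ, x j = (z : ℝ)) ∧
        ∀ y ∈ F (H ∪ Pk1), (∀ j, ∃ z : ℤ, y j = (z : ℝ)) → c ⬝ᵥ x ≤ c ⬝ᵥ y} =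
    {x | x ∈ F H ∧ (∀ j, ∃ z : ℤ, x j = (z : ℝ)) ∧
        ∀ y ∈ F H, (∀ j, ∃ z : ℤ, y j = (z : ℝ)) → c ⬝ᵥ x ≤ c ⬝ᵥ y} := by
  have key : ∀ y, (∀ j, ∃ z : ℤ, y j = (z : ℝ)) → (y ∈ F (H ∪ Pk1) ↔ y ∈ F H) := by
    intro y hy
    refine ⟨fun h => ?_, fun h => ?_⟩
    · rw [hF, Set.mem_ofPred_eq] at h ⊢
      exact fun p hp => h p (Finset.mem_union_left _ hp)
    · have hcuts := hvalid y h hy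
      have hH : ∀ p ∈ H, p.1 ⬝ᵥ y ≤ p.2 := by simpa only [hF, Set.mem_ofPred_eq] using h
      have hPhat : ∀ p ∈ Phat, p.1 ⬝ᵥ y ≤ p.2 := fun p hp =>
        (Finset.mem_union.1 (hsub hp)).elim (hH p) (hcuts p)
      have hle : c ⬝ᵥ xk ≤ c ⬝ᵥ y := by
        apply hxkmin
        rw [hF]
        exact fun p hp => (Finset.mem_union.1 hp).elim (hH p) (hPhat p)
      have hceil : ((⌈c ⬝ᵥ xk⌉ : ℤ) : ℝ) ≤ c ⬝ᵥ y := by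
        obtain ⟨m, hm⟩ := exists_int_eq_dotProduct hc hy
        rw [hm] at hle ⊢
        exact_mod_cast Int.ceil_le.2 hle
      rw [hF, hPk1]
      intro p hp
      rcases Finset.mem_union.1 hp with hp | hp
      · exact hH p hp
      · rcases Finset.mem_insert.1 hp with rfl | hp
        · simpa only [neg_dotProduct, neg_le_neg_iff] using hceil
        · exact hPhat p hp
  ext x
  constructor
  · rintro ⟨hx, hxint, hmin⟩
    exact ⟨(key x hxint).1 hx, hxint, fun y hy hyint => hmin y ((key y hyint).2 hy) hyint⟩
  · rintro ⟨hx, hxint, hmin⟩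
    exact ⟨(key x hxint).2 hx, hxint, fun y hy hyint => hmin y ((key y hyint).1 hy) hyint⟩
end
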